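/- Let R be a commutative ring with unity, let k ∈ ℕ, and let I_1, I_2, …, I_{2k} be mutually co-maximal ideals of R (I_i + I_j = R for all i ≠ j). Let I = I_1·I_2⋯I_{2k} and suppose that either I satisfies the USC or I = R. Let J ⊆ R be an ideal with J + I = R such that either I·J satisfies the USC or I·J = R, and let Γ ⊆ SP_{2k}(R) be any subgroup containing the principal congruence ideal subgroup Γ_k(J). Let M = [m_{i,j}]_{1 ≤ i,j ≤ 2k} be a 2k×2k matrix over R each of whose rows is unital, i.e., ⟨m_{i,1}⟩ + ⟨m_{i,2}⟩ + ⋯ + ⟨m_{i,2k}⟩ = R for every 1 ≤ i ≤ 2k. Then there exists N = [n_{i,j}]_{1 ≤ i,j ≤ 2k} ∈ Γ such that m_{i,j} ≡ n_{i,j} mod I_i for all 1 ≤ i, j ≤ 2k. -/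

import Mathlib

open Matrix

/-- An ideal `I` satisfies the unital set condition (USC): for every unital tuple
`a₁, …, aₖ` with `k ≥ 2` (possibly with repetitions) generating the unit ideal, there is
`b ∈ ⟨a₂, …, aₖ⟩` such that `a₁ + b` is a unit modulo `I`. -/
def SatisfiesUSC {R : Type*} [CommRing R] (I : Ideal R) : Prop :=
  ∀ (k : ℕ) (a : Fin (k + 2) → R), Ideal.span (Set.range a) = ⊤ →
    ∃ b ∈ Ideal.span (Set.range fun i : Fin (k + 1) => a i.succ),
      IsUnit (Ideal.Quotient.mk I (a 0 + b))

lemma J_map {l : Type*} [DecidableEq l] [Fintype l] {R S : Type*} [CommRing R] [CommRing S]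
    (f : R →+* S) : (Matrix.J l R).map f = Matrix.J l S := by
  ext i j
  cases i <;> cases j <;>
    simp [Matrix.J, Matrix.fromBlocks, Matrix.map_apply, Matrix.one_apply, apply_ite f]

/-- The reduction homomorphism on symplectic groups induced by a ring homomorphism. -/
def SpMap {l : Type*} [DecidableEq l] [Fintype l] {R S : Type*} [CommRing R] [CommRing S]
    (f : R →+* S) : Matrix.symplecticGroup l R →* Matrix.symplecticGroup l S where
  toFun A := ⟨A.1.map f, by
    have h := A.2
    rw [SymplecticGroup.mem_iff] at h ⊢
    rw [← J_map f, ← Matrix.transpose_map, ← Matrix.map_mul, ← Matrix.map_mul, h]⟩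
  map_one' := Subtype.ext (Matrix.map_one f f.map_zero f.map_one)
  map_mul' A B := Subtype.ext (Matrix.map_mul)

/-- The principal congruence ideal subgroup `Γ(J)` of `SP_{2k}(R)`, the kernel of the
reduction homomorphism `SP_{2k}(R) → SP_{2k}(R/J)`. -/
def SpGamma {R : Type*} [CommRing R] (k : ℕ) (J : Ideal R) :
    Subgroup (Matrix.symplecticGroup (Fin k) R) :=
  (SpMap (Ideal.Quotient.mk J)).ker

section helpers
variable {R : Type*} [CommRing R] {k : ℕ}

/-- The symplectic form, `x J uᵀ`. -/
lemma omega_self (u : Fin k ⊕ Fin k → R) : u ⬝ᵥ (Matrix.J (Fin k) R *ᵥ u) = 0 := by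
  have h : Matrix.J (Fin k) R *ᵥ u = Sum.elim (fun i => - u (Sum.inr i)) (fun i => u (Sum.inl i)) := by
    conv_lhs => rw [← Sum.elim_comp_inl_inr u]
    rw [Matrix.J, Matrix.fromBlocks_mulVec]
    ext i
    cases i <;> simp [Matrix.neg_mulVec]
  rw [h, dotProduct, Fintype.sum_sum_type]
  simp only [Sum.elim_inl, Sum.elim_inr]
  rw [← Finset.sum_add_distrib]
  exact Finset.sum_eq_zero fun i _ => by ring

lemma transv_mem (t : R) (u : Fin k ⊕ Fin k → R) :
    (1 + t • vecMulVec (Matrix.J (Fin k) R *ᵥ u) u) ∈ Matrix.symplecticGroup (Fin k) R := by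
  rw [SymplecticGroup.mem_iff]
  have h1 : vecMulVec (Matrix.J (Fin k) R *ᵥ u) u * Matrix.J (Fin k) R
      = - vecMulVec (Matrix.J (Fin k) R *ᵥ u) (Matrix.J (Fin k) R *ᵥ u) := by
    rw [vecMulVec_mul, ← Matrix.mulVec_transpose, Matrix.J_transpose, Matrix.neg_mulVec]
    ext i j
    simp [vecMulVec_apply]
  have h2 : Matrix.J (Fin k) R * vecMulVec u (Matrix.J (Fin k) R *ᵥ u)
      = vecMulVec (Matrix.J (Fin k) R *ᵥ u) (Matrix.J (Fin k) R *ᵥ u) := by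
    rw [mul_vecMulVec]
  have h3 : vecMulVec (Matrix.J (Fin k) R *ᵥ u) (Matrix.J (Fin k) R *ᵥ u) *
      vecMulVec u (Matrix.J (Fin k) R *ᵥ u) = 0 := by
    rw [vecMulVec_mul_vecMulVec, dotProduct_comm, omega_self]
    ext i j
    simp [vecMulVec_apply]
  rw [transpose_add, transpose_smul, transpose_vecMulVec, transpose_one, add_mul, one_mul,
    smul_mul_assoc, h1, mul_add, add_mul, add_mul, mul_one, mul_one, mul_smul_comm, h2,
    smul_mul_assoc, mul_smul_comm, neg_mul, h3]
  simp

/-- Symplectic transvection. -/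
def transv (t : R) (u : Fin k ⊕ Fin k → R) : Matrix.symplecticGroup (Fin k) R :=
  ⟨1 + t • vecMulVec (Matrix.J (Fin k) R *ᵥ u) u, transv_mem t u⟩

lemma transv_vecMul (t : R) (u x : Fin k ⊕ Fin k → R) :
    x ᵥ* (transv t u).1 = x + (t * (x ⬝ᵥ (Matrix.J (Fin k) R *ᵥ u))) • u := by
  rw [transv, vecMul_add, vecMul_one, vecMul_smul, vecMul_vecMulVec, smul_smul]

lemma transv_red {L : Ideal R} {t : R} (ht : t ∈ L) (u : Fin k ⊕ Fin k → R) :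
    SpMap (Ideal.Quotient.mk L) (transv t u) = 1 := by
  apply Subtype.ext
  ext i j
  have : Ideal.Quotient.mk L t = 0 := Ideal.Quotient.eq_zero_iff_mem.2 ht
  simp [SpMap, transv, this, Matrix.one_apply, apply_ite (Ideal.Quotient.mk L)]

/-- If `ω(x,y)` is a unit mod `P`, a transvection trivial mod every ideal containing `ε` moves
`x` to `y` mod `P`. -/
lemma transv_move {P : Ideal R} {ε : R} (hε : ε - 1 ∈ P) (x y : Fin k ⊕ Fin k → R)
    (h : IsUnit (Ideal.Quotient.mk P (x ⬝ᵥ (Matrix.J (Fin k) R *ᵥ y)))) :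
    ∃ t, ∀ j, y j - (x ᵥ* (transv (ε * t) (y - x)).1) j ∈ P := by
  obtain ⟨c, hc⟩ := h.exists_right_inv
  obtain ⟨c, rfl⟩ := Ideal.Quotient.mk_surjective c
  refine ⟨c, fun j => ?_⟩
  have he : Ideal.Quotient.mk P ε = 1 := by
    rw [← map_one (Ideal.Quotient.mk P)]; exact Ideal.Quotient.eq.2 hε
  rw [transv_vecMul, mulVec_sub, dotProduct_sub, omega_self, sub_zero]
  rw [← Ideal.Quotient.eq_zero_iff_mem]
  simp only [Pi.add_apply, Pi.smul_apply, Pi.sub_apply, smul_eq_mul, map_sub, map_add, map_mul, he]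
  linear_combination (-(Ideal.Quotient.mk P (y j) - Ideal.Quotient.mk P (x j))) * hc

lemma usc_row {K P : Ideal R} (hK : SatisfiesUSC K) (hKP : K ≤ P)
    (i : Fin k ⊕ Fin k) (v : Fin k ⊕ Fin k → R) (hv : Ideal.span (Set.range v) = ⊤) :
    ∃ d : Fin k ⊕ Fin k → R, d i = 1 ∧ IsUnit (Ideal.Quotient.mk P (d ⬝ᵥ v)) := by
  classical
  obtain ⟨m, hm⟩ : ∃ m, Fintype.card (Fin k ⊕ Fin k) = m + 1 :=
    Nat.exists_eq_succ_of_ne_zero (Fintype.card_pos_iff.2 ⟨i⟩).ne'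
  let e : Fin (m + 1) ≃ (Fin k ⊕ Fin k) := ((Fintype.equivFin _).trans (finCongr hm)).symm
  let v' := Function.update v i 0
  obtain ⟨b, hb, hu⟩ := hK m (Fin.cons (v i) (v' ∘ e)) (by
    rw [eq_top_iff, ← hv, Ideal.span_le]
    rintro _ ⟨j, rfl⟩
    apply Ideal.subset_span
    by_cases h : j = i
    · exact ⟨0, by simp [h]⟩
    · exact ⟨(e.symm j).succ, by simp [v', h]⟩)
  simp only [Fin.cons_succ, Fin.cons_zero] at hb hu
  obtain ⟨c, hc⟩ := (Ideal.mem_span_range_iff_exists_fun).1 hb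
  refine ⟨Function.update (c ∘ e.symm) i 1, by simp, ?_⟩
  have h1 : Function.update (c ∘ e.symm) i 1 ⬝ᵥ v = v i + b := by
    rw [← hc, ← Equiv.sum_comp e.symm, dotProduct,
      ← Finset.add_sum_erase _ _ (Finset.mem_univ i), ← Finset.add_sum_erase (a := i) _ (fun j => c (e.symm j) * _) (Finset.mem_univ i)]
    simp only [Function.update_self, one_mul, Function.comp, Equiv.apply_symm_apply, v', mul_zero,
      zero_add]
    congr 1
    refine Finset.sum_congr rfl fun j hj => ?_
    rw [Function.update_of_ne (Finset.ne_of_mem_erase hj),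
      Function.update_of_ne (Finset.ne_of_mem_erase hj), Function.comp_apply]
  rw [h1]
  simpa using hu.map (Ideal.Quotient.factor hKP)

lemma exists_local {K P : Ideal R} (hK : SatisfiesUSC K) (hKP : K ≤ P) {ε : R} (hε : ε - 1 ∈ P)
    (i : Fin k ⊕ Fin k) (v : Fin k ⊕ Fin k → R) (hv : Ideal.span (Set.range v) = ⊤) :
    ∃ N : Matrix.symplecticGroup (Fin k) R,
      (∀ L : Ideal R, ε ∈ L → SpMap (Ideal.Quotient.mk L) N = 1) ∧ ∀ j, v j - N.1 i j ∈ P := by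
  obtain ⟨d, hd, hu⟩ := usc_row hK hKP i v hv
  let z : Fin k ⊕ Fin k → R := Matrix.J (Fin k) R *ᵥ d
  have hJz : Matrix.J (Fin k) R *ᵥ z = -d := by
    simp only [z, mulVec_mulVec, Matrix.J_squared, neg_mulVec, one_mulVec]
  have hzv : z ⬝ᵥ (Matrix.J (Fin k) R *ᵥ v) = d ⬝ᵥ v := by
    rw [dotProduct_mulVec, ← mulVec_transpose, Matrix.J_transpose, neg_mulVec, hJz, neg_neg]
  obtain ⟨t, ht⟩ := transv_move hε (Pi.single i 1) z (by
    rw [hJz]; simp [hd])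
  obtain ⟨s, hs⟩ := transv_move hε z v (by rwa [hzv])
  set A := transv (ε * t) (z - Pi.single i 1)
  set B := transv (ε * s) (v - z)
  refine ⟨A * B, fun L hL => ?_, fun j => ?_⟩
  · rw [map_mul, transv_red (L.mul_mem_right _ hL), transv_red (L.mul_mem_right _ hL), one_mul]
  · have h1 : (A * B).1 i j = ((Pi.single i 1 ᵥ* A.1) ᵥ* B.1) j := by
      rw [vecMul_vecMul, single_one_vecMul]; rfl
    have h2 : v j - (A * B).1 i j = (v j - (z ᵥ* B.1) j) +
        ((z - Pi.single i 1 ᵥ* A.1) ᵥ* B.1) j := by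
      rw [h1, sub_vecMul, Pi.sub_apply]; ring
    rw [h2]
    refine P.add_mem (hs j) ?_
    rw [vecMul, dotProduct]
    exact P.sum_mem fun l _ => P.mul_mem_right _ (ht l)

lemma red_eq {P : Ideal R} {N : Matrix.symplecticGroup (Fin k) R}
    (h : SpMap (Ideal.Quotient.mk P) N = 1) :
    N.1.map (Ideal.Quotient.mk P) = 1 := congrArg Subtype.val h

lemma mul_right_red {P : Ideal R} {N N' : Matrix.symplecticGroup (Fin k) R}
    (h : SpMap (Ideal.Quotient.mk P) N' = 1) (i j) : N.1 i j - (N * N').1 i j ∈ P := by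
  have : (N * N').1.map (Ideal.Quotient.mk P) = N.1.map (Ideal.Quotient.mk P) := by
    rw [show (N * N').1 = N.1 * N'.1 from rfl, Matrix.map_mul, red_eq h, mul_one]
  exact Ideal.Quotient.eq.1 (congrFun (congrFun this i) j).symm

lemma mul_left_red {P : Ideal R} {N N' : Matrix.symplecticGroup (Fin k) R}
    (h : SpMap (Ideal.Quotient.mk P) N' = 1) (i j) : N.1 i j - (N' * N).1 i j ∈ P := by
  have : (N' * N).1.map (Ideal.Quotient.mk P) = N.1.map (Ideal.Quotient.mk P) := by
    rw [show (N' * N).1 = N'.1 * N.1 from rfl, Matrix.map_mul, red_eq h, one_mul]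
  exact Ideal.Quotient.eq.1 (congrFun (congrFun this i) j).symm

end helpers

theorem stmt3 {R : Type*} [CommRing R] (k : ℕ) (I : Fin k ⊕ Fin k → Ideal R)
    (hco : ∀ i j, i ≠ j → I i ⊔ I j = ⊤)
    (hI : SatisfiesUSC (∏ i, I i) ∨ (∏ i, I i) = ⊤)
    (J : Ideal R) (hJI : J ⊔ (∏ i, I i) = ⊤)
    (hIJ : SatisfiesUSC ((∏ i, I i) * J) ∨ (∏ i, I i) * J = ⊤)
    (Γ : Subgroup (Matrix.symplecticGroup (Fin k) R))
    (hΓ : SpGamma k J ≤ Γ)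
    (M : Matrix (Fin k ⊕ Fin k) (Fin k ⊕ Fin k) R)
    (hM : ∀ i, Ideal.span (Set.range (M i)) = ⊤) :
    ∃ N ∈ Γ, ∀ i j, M i j - (N : Matrix.symplecticGroup (Fin k) R).1 i j ∈ I i := by
  classical
  have hK : SatisfiesUSC ((∏ i, I i) * J) := by
    rcases hIJ with h | h
    · exact h
    · rw [h]
      intro n a _
      have : Subsingleton (R ⧸ (⊤ : Ideal R)) := Ideal.Quotient.subsingleton_iff.2 rfl
      exact ⟨0, Ideal.zero_mem _, isUnit_of_subsingleton _⟩
  have hle : ∀ i, (∏ i, I i) ≤ I i := fun i =>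
    Ideal.prod_le_inf.trans (Finset.inf_le (Finset.mem_univ i))
  have key : ∀ i, ∃ N : Matrix.symplecticGroup (Fin k) R,
      SpMap (Ideal.Quotient.mk J) N = 1 ∧
      (∀ j, j ≠ i → SpMap (Ideal.Quotient.mk (I j)) N = 1) ∧
      ∀ j, M i j - N.1 i j ∈ I i := by
    intro i
    have h1 : I i ⊔ ∏ j ∈ Finset.univ.erase i, I j = ⊤ :=
      Ideal.sup_prod_eq_top fun j hj => hco i j (Finset.ne_of_mem_erase hj).symm
    have h2 : I i ⊔ J = ⊤ := by
      rw [eq_top_iff, ← hJI, sup_comm]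
      exact sup_le_sup_right (hle i) _
    have h3 : I i ⊔ J * ∏ j ∈ Finset.univ.erase i, I j = ⊤ := by
      rw [Ideal.sup_mul_eq_of_coprime_left h2, h1]
    obtain ⟨p, hp, ε, hε, hpe⟩ := Submodule.mem_sup.1 ((Ideal.eq_top_iff_one _).1 h3)
    have hKi : (∏ i, I i) * J ≤ I i := le_trans Ideal.mul_le_left (hle i)
    have hε1 : ε - 1 ∈ I i := by
      have : ε - 1 = -p := by rw [← hpe]; ring
      rw [this]; exact (I i).neg_mem hp
    have hεJ : ε ∈ J := Ideal.mul_le_left hε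
    have hεj : ∀ j, j ≠ i → ε ∈ I j := by
      intro j hj
      have h4 : ∏ j ∈ Finset.univ.erase i, I j ≤ I j :=
        le_trans Ideal.prod_le_inf (Finset.inf_le (Finset.mem_erase.2 ⟨hj, Finset.mem_univ j⟩))
      exact h4 (Ideal.mul_le_right hε)
    obtain ⟨N, hN, hN'⟩ := exists_local hK hKi hε1 i (M i) (hM i)
    exact ⟨N, hN _ hεJ, fun j hj => hN _ (hεj j hj), hN'⟩
  choose F hFJ hF1 hF using key
  have main : ∀ s : Finset (Fin k ⊕ Fin k), ∃ N : Matrix.symplecticGroup (Fin k) R,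
      SpMap (Ideal.Quotient.mk J) N = 1 ∧
      (∀ i, i ∉ s → SpMap (Ideal.Quotient.mk (I i)) N = 1) ∧
      ∀ i ∈ s, ∀ j, M i j - N.1 i j ∈ I i := by
    intro s
    induction s using Finset.induction_on with
    | empty => exact ⟨1, map_one _, fun _ _ => map_one _, by simp⟩
    | insert a s ha ih =>
      obtain ⟨N, hNJ, hN1, hN⟩ := ih
      refine ⟨N * F a, by rw [map_mul, hNJ, hFJ, one_mul], fun i hi => ?_, fun i hi j => ?_⟩
      · rw [Finset.mem_insert, not_or] at hi
        rw [map_mul, hN1 i hi.2, hF1 a i hi.1, one_mul]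
      · rcases Finset.mem_insert.1 hi with rfl | hi
        · have := (I i).add_mem (hF i j) (mul_left_red (N := F i) (hN1 i ha) i j)
          rwa [sub_add_sub_cancel] at this
        · have hia : i ≠ a := fun h => ha (h ▸ hi)
          have := (I i).add_mem (hN i hi j) (mul_right_red (N := N) (hF1 a i hia) i j)
          rwa [sub_add_sub_cancel] at this
  obtain ⟨N, hNJ, -, hN⟩ := main Finset.univ
  exact ⟨N, hΓ (MonoidHom.mem_ker.2 hNJ), fun i j => hN i (Finset.mem_univ i) j⟩
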